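/- arXiv:1511.04694 — 2 statements merged into one kernel-verified Lean document; each statement's English description precedes it below -/
import Mathlib

section
/- For every u > 0 and ς ≥ 1, the functions F_u, G_u and H_{u,ς} are entire (complex differentiable on all of ℂ) and even; consequently there exist entire functions F̃_u, G̃_u, H̃_{u,ς} : ℂ → ℂ such that F̃_u(a²) = F_u(a), G̃_u(a²) = G_u(a) and H̃_{u,ς}(a²) = H_{u,ς}(a) for all a ∈ ℂ. -/
open MeasureTheory

/-- The function `F_u` of the paper. -/
noncomputable def Fcut (f : ℝ → ℝ) (u : ℝ) (a : ℂ) : ℂ :=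
  ((Real.sqrt (2 * Real.pi))⁻¹ : ℂ) *
    ∫ v : ℝ, Complex.exp (Complex.I * v * Real.sqrt 2 * a) * Complex.exp (-(v : ℂ) ^ 2 / 2) *
      ((f (Real.sqrt u * v) : ℝ) : ℂ)

/-- The function `G_u` of the paper. -/
noncomputable def Gcut (f : ℝ → ℝ) (u : ℝ) (a : ℂ) : ℂ :=
  ((Real.sqrt (2 * Real.pi))⁻¹ : ℂ) *
    ∫ v : ℝ, Complex.exp (Complex.I * v * Real.sqrt 2 * a) * Complex.exp (-(v : ℂ) ^ 2 / 2) *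
      ((1 - f (Real.sqrt u * v) : ℝ) : ℂ)

/-- The function `H_{u,ς}` of the paper:
`H_{u,ς}(a) = (2π)^{-1/2} ∫_ℝ e^{iv√2 a} e^{-v²/(2u)} (1 - f(√ς·v)) dv`. -/
noncomputable def Hcut (f : ℝ → ℝ) (u ς : ℝ) (a : ℂ) : ℂ :=
  ((Real.sqrt (2 * Real.pi))⁻¹ : ℂ) *
    ∫ v : ℝ, Complex.exp (Complex.I * v * Real.sqrt 2 * a) *
      Complex.exp (-(v : ℂ) ^ 2 / (2 * (u : ℂ))) * ((1 - f (Real.sqrt ς * v) : ℝ) : ℂ)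

lemma aux_sqrt (φ : ℂ → ℂ) (hd : Differentiable ℂ φ) (he : ∀ a, φ (-a) = φ a) :
    ∃ ψ : ℂ → ℂ, Differentiable ℂ ψ ∧ ∀ a, ψ (a ^ 2) = φ a := by
  have key : ∀ a b : ℂ, a ^ 2 = b ^ 2 → φ a = φ b := by
    intro a b h
    rcases sq_eq_sq_iff_eq_or_eq_neg.mp h with h | h
    · rw [h]
    · rw [h, he]
  have hsq : ∀ z : ℂ, (z ^ (1 / 2 : ℂ)) ^ 2 = z := by
    intro z
    have := Complex.cpow_nat_inv_pow z (n := 2) (by norm_num)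
    simpa using this
  refine ⟨fun z => φ (z ^ (1 / 2 : ℂ)), ?_, fun a => key _ _ (hsq _)⟩
  have hoff : ∀ z : ℂ, z ≠ 0 → DifferentiableAt ℂ (fun z => φ (z ^ (1 / 2 : ℂ))) z := by
    intro z hz
    by_cases hs : z ∈ Complex.slitPlane
    · exact (hd _).comp z (DifferentiableAt.cpow_const differentiableAt_id hs)
    · have hs' : -z ∈ Complex.slitPlane := by
        rw [Complex.mem_slitPlane_iff] at hs ⊢
        push Not at hs
        left
        have : z.re ≠ 0 := fun h => hz (Complex.ext h hs.2)
        simpa using lt_of_le_of_ne hs.1 this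
      have e : (fun z => φ (z ^ (1 / 2 : ℂ)))
          = fun z => φ (Complex.I * (-z) ^ (1 / 2 : ℂ)) := by
        funext w
        apply key
        rw [mul_pow, hsq, hsq]
        simp
      rw [e]
      exact (hd _).comp z ((DifferentiableAt.cpow_const differentiableAt_id.neg hs').const_mul _)
  have h0 : ContinuousAt (fun z => φ (z ^ (1 / 2 : ℂ))) 0 := by
    apply ContinuousAt.comp (g := φ) hd.continuous.continuousAt
    exact Complex.continuousAt_cpow_const_of_re_pos (by simp) (by norm_num)
  have := (Complex.differentiableOn_compl_singleton_and_continuousAt_iff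
    (f := fun z => φ (z ^ (1 / 2 : ℂ))) (s := Set.univ) (c := 0) Filter.univ_mem).1
    ⟨fun z hz => (hoff z hz.2).differentiableWithinAt, h0⟩
  exact differentiableOn_univ.1 this

lemma aux_even (k g : ℝ → ℂ) (hk : ∀ v, k (-v) = k v) (hg : ∀ v, g (-v) = g v) (a : ℂ) :
    ∫ v : ℝ, Complex.exp (Complex.I * v * Real.sqrt 2 * (-a)) * k v * g v =
    ∫ v : ℝ, Complex.exp (Complex.I * v * Real.sqrt 2 * a) * k v * g v := by
  rw [← integral_neg_eq_self]
  congr 1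
  funext v
  rw [hk, hg]
  congr 3
  push_cast
  ring

lemma aux_bound (c R : ℝ) (hc : 0 < c) :
    Integrable (fun v : ℝ => Real.exp (R * |v|) * Real.exp (-v ^ 2 / (2 * c))) := by
  have h : ∀ r : ℝ, Integrable (fun v : ℝ => Real.exp (r * v - v ^ 2 / (2 * c))) := by
    intro r
    have := (integrable_cexp_quadratic (b := ((1 / (2 * c) : ℝ) : ℂ))
      (by rw [Complex.ofReal_re]; positivity) (r : ℂ) 0).norm
    refine this.congr (Filter.Eventually.of_forall fun v => ?_)
    simp only [Complex.norm_exp]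
    congr 1
    have : (-((1 / (2 * c) : ℝ) : ℂ) * (v : ℂ) ^ 2 + (r : ℂ) * v + 0)
      = ((r * v - v ^ 2 / (2 * c) : ℝ) : ℂ) := by push_cast; ring
    rw [this, Complex.ofReal_re]
  refine ((h R).add (h (-R))).mono' (by fun_prop) (Filter.Eventually.of_forall fun v => ?_)
  rw [← Real.exp_add, Real.norm_of_nonneg (Real.exp_pos _).le]
  simp only [Pi.add_apply]
  rcases abs_choice v with h | h <;> rw [h]
  · rw [show R * v + -v ^ 2 / (2 * c) = R * v - v ^ 2 / (2 * c) by ring]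
    linarith [Real.exp_pos (-R * v - v ^ 2 / (2 * c))]
  · rw [show R * -v + -v ^ 2 / (2 * c) = -R * v - v ^ 2 / (2 * c) by ring]
    linarith [Real.exp_pos (R * v - v ^ 2 / (2 * c))]

lemma aux_diff (c : ℝ) (hc : 0 < c) (g : ℝ → ℝ) (hg : Continuous g)
    (hb : ∀ v, |g v| ≤ 1) :
    Differentiable ℂ (fun a : ℂ => ∫ v : ℝ, Complex.exp (Complex.I * v * Real.sqrt 2 * a) *
      Complex.exp (-(v : ℂ) ^ 2 / (2 * (c : ℂ))) * ((g v : ℝ) : ℂ)) := by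
  have hk : ∀ v : ℝ, ‖Complex.exp (-(v : ℂ) ^ 2 / (2 * (c : ℂ)))‖
      = Real.exp (-v ^ 2 / (2 * c)) := by
    intro v
    rw [Complex.norm_exp, show (-(v : ℂ) ^ 2 / (2 * (c : ℂ)))
      = ((-v ^ 2 / (2 * c) : ℝ) : ℂ) by push_cast; ring, Complex.ofReal_re]
  have he : ∀ (v : ℝ) (a : ℂ), ‖Complex.exp (Complex.I * v * Real.sqrt 2 * a)‖
      ≤ Real.exp (Real.sqrt 2 * ‖a‖ * |v|) := by
    intro v a
    refine (Complex.norm_exp_le_exp_norm _).trans (Real.exp_le_exp.2 (le_of_eq ?_))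
    simp only [norm_mul, Complex.norm_I, Complex.norm_real, Real.norm_eq_abs,
      abs_of_nonneg (Real.sqrt_nonneg 2)]
    ring
  intro a₀
  have main := hasDerivAt_integral_of_dominated_loc_of_deriv_le (μ := volume) (𝕜 := ℂ)
    (F := fun (a : ℂ) (v : ℝ) => Complex.exp (Complex.I * v * Real.sqrt 2 * a) *
      Complex.exp (-(v : ℂ) ^ 2 / (2 * (c : ℂ))) * ((g v : ℝ) : ℂ))
    (F' := fun (a : ℂ) (v : ℝ) => Complex.exp (Complex.I * v * Real.sqrt 2 * a) *
      (Complex.I * v * Real.sqrt 2) *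
      Complex.exp (-(v : ℂ) ^ 2 / (2 * (c : ℂ))) * ((g v : ℝ) : ℂ))
    (x₀ := a₀) (s := Metric.ball a₀ 1)
    (bound := fun v : ℝ => Real.exp ((Real.sqrt 2 * (‖a₀‖ + 1) + Real.sqrt 2) * |v|) *
      Real.exp (-v ^ 2 / (2 * c)))
    (Metric.ball_mem_nhds a₀ one_pos) ?_ ?_ ?_ ?_ (aux_bound c _ hc) ?_
  · exact main.2.differentiableAt
  · exact Filter.Eventually.of_forall fun a =>
      Continuous.aestronglyMeasurable (by fun_prop)
  · refine (aux_bound c (Real.sqrt 2 * ‖a₀‖) hc).mono'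
      (Continuous.aestronglyMeasurable (by fun_prop)) (Filter.Eventually.of_forall fun v => ?_)
    rw [norm_mul, norm_mul, hk, Complex.norm_real, Real.norm_eq_abs]
    refine (mul_le_of_le_one_right (by positivity) (hb v)).trans ?_
    gcongr
    exact he v a₀
  · exact Continuous.aestronglyMeasurable (by fun_prop)
  · refine Filter.Eventually.of_forall fun v a ha => ?_
    have ha' : ‖a‖ ≤ ‖a₀‖ + 1 := by
      have h1 : ‖a - a₀‖ < 1 := by simpa [dist_eq_norm] using ha
      have h2 := norm_add_le (a - a₀) a₀
      rw [sub_add_cancel] at h2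
      linarith
    rw [norm_mul, norm_mul, norm_mul, hk, Complex.norm_real (g v), Real.norm_eq_abs]
    refine (mul_le_of_le_one_right (by positivity) (hb v)).trans ?_
    gcongr
    rw [add_mul, Real.exp_add]
    gcongr
    · refine (he v a).trans (Real.exp_le_exp.2 ?_)
      gcongr
    · simp only [norm_mul, Complex.norm_I, Complex.norm_real, Real.norm_eq_abs,
        abs_of_nonneg (Real.sqrt_nonneg 2)]
      have := Real.add_one_le_exp (Real.sqrt 2 * |v|)
      linarith
  · refine Filter.Eventually.of_forall fun v a _ => ?_
    have h1 : HasDerivAt (fun a : ℂ => Complex.I * v * Real.sqrt 2 * a)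
        (Complex.I * v * Real.sqrt 2) a := by
      simpa using (hasDerivAt_id a).const_mul (Complex.I * v * Real.sqrt 2 : ℂ)
    exact (h1.cexp.mul_const _).mul_const _

/-- `F_u`, `G_u` and `H_{u,ς}` are entire and even; consequently there are entire functions
`F̃_u`, `G̃_u`, `H̃_{u,ς}` with `F̃_u(a²) = F_u(a)`, `G̃_u(a²) = G_u(a)`, `H̃_{u,ς}(a²) = H_{u,ς}(a)`. -/
theorem entire_even_and_exists_tilde (ε : ℝ) (hε : 0 < ε) (f : ℝ → ℝ)
    (hf_smooth : ContDiff ℝ (⊤ : ℕ∞) f)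
    (hf_even : ∀ t, f (-t) = f t)
    (hf_range : ∀ t, f t ∈ Set.Icc (0 : ℝ) 1)
    (hf_one : ∀ t, |t| < ε / 2 → f t = 1)
    (hf_zero : ∀ t, ε < |t| → f t = 0)
    (u ς : ℝ) (hu : 0 < u) (hς : 1 ≤ ς) :
    Differentiable ℂ (Fcut f u) ∧ (∀ a : ℂ, Fcut f u (-a) = Fcut f u a) ∧
    Differentiable ℂ (Gcut f u) ∧ (∀ a : ℂ, Gcut f u (-a) = Gcut f u a) ∧
    Differentiable ℂ (Hcut f u ς) ∧ (∀ a : ℂ, Hcut f u ς (-a) = Hcut f u ς a) ∧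
    ∃ Ft Gt Ht : ℂ → ℂ,
      Differentiable ℂ Ft ∧ Differentiable ℂ Gt ∧ Differentiable ℂ Ht ∧
      (∀ a : ℂ, Ft (a ^ 2) = Fcut f u a) ∧
      (∀ a : ℂ, Gt (a ^ 2) = Gcut f u a) ∧
      (∀ a : ℂ, Ht (a ^ 2) = Hcut f u ς a) := by
  have hc : Continuous f := hf_smooth.continuous
  have hb1 : ∀ t, |f t| ≤ 1 := fun t => by
    have := hf_range t
    exact abs_le.2 ⟨by linarith [this.1], this.2⟩
  have hb2 : ∀ t, |1 - f t| ≤ 1 := fun t => by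
    have := hf_range t
    exact abs_le.2 ⟨by linarith [this.2], by linarith [this.1]⟩
  have dF : Differentiable ℂ (Fcut f u) := by
    have := aux_diff 1 one_pos (fun v => f (Real.sqrt u * v)) (by fun_prop) (fun v => hb1 _)
    simp only [Complex.ofReal_one, mul_one] at this
    exact this.const_mul _
  have dG : Differentiable ℂ (Gcut f u) := by
    have := aux_diff 1 one_pos (fun v => 1 - f (Real.sqrt u * v)) (by fun_prop) (fun v => hb2 _)
    simp only [Complex.ofReal_one, mul_one] at this
    exact this.const_mul _
  have dH : Differentiable ℂ (Hcut f u ς) :=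
    (aux_diff u hu (fun v => 1 - f (Real.sqrt ς * v)) (by fun_prop) (fun v => hb2 _)).const_mul _
  have eF : ∀ a : ℂ, Fcut f u (-a) = Fcut f u a := fun a =>
    congrArg (fun z : ℂ => ((Real.sqrt (2 * Real.pi))⁻¹ : ℂ) * z) (aux_even (fun v => Complex.exp (-(v : ℂ) ^ 2 / 2))
      (fun v => ((f (Real.sqrt u * v) : ℝ) : ℂ)) (by simp) (by simp [hf_even]) a)
  have eG : ∀ a : ℂ, Gcut f u (-a) = Gcut f u a := fun a =>
    congrArg (fun z : ℂ => ((Real.sqrt (2 * Real.pi))⁻¹ : ℂ) * z) (aux_even (fun v => Complex.exp (-(v : ℂ) ^ 2 / 2))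
      (fun v => ((1 - f (Real.sqrt u * v) : ℝ) : ℂ)) (by simp) (by simp [hf_even]) a)
  have eH : ∀ a : ℂ, Hcut f u ς (-a) = Hcut f u ς a := fun a =>
    congrArg (fun z : ℂ => ((Real.sqrt (2 * Real.pi))⁻¹ : ℂ) * z) (aux_even (fun v => Complex.exp (-(v : ℂ) ^ 2 / (2 * (u : ℂ))))
      (fun v => ((1 - f (Real.sqrt ς * v) : ℝ) : ℂ)) (by simp) (by simp [hf_even]) a)
  obtain ⟨Ft, h1, h2⟩ := aux_sqrt _ dF eF
  obtain ⟨Gt, h3, h4⟩ := aux_sqrt _ dG eG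
  obtain ⟨Ht, h5, h6⟩ := aux_sqrt _ dH eH
  exact ⟨dF, eF, dG, eG, dH, eH, Ft, Gt, Ht, h1, h3, h5, h2, h4, h6⟩
end

section
/- Let N ≥ 1 and let (f_j)_{j∈ℕ} be a sequence of smooth functions ℝ^N → ℂ such that: (i) for every k ∈ ℕ there is a constant C_k with sup_j sup_{x∈ℝ^N} ‖D^k f_j(x)‖ ≤ C_k, where D^k denotes the k-th iterated (Fréchet) derivative; (ii) for every Schwartz function φ on ℝ^N the sequence of integrals ∫_{ℝ^N} f_j(x) φ(x) dx converges in ℂ. Then there exists a smooth function f : ℝ^N → ℂ, all of whose derivatives are bounded, such that ∫ f_j φ → ∫ f φ for every Schwartz function φ, and for every k ∈ ℕ the derivatives D^k f_j converge to D^k f uniformly on every compact subset of ℝ^N. -/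
open MeasureTheory Filter

/-- A sequence which is approximated arbitrarily well by Cauchy sequences is Cauchy. -/
lemma aux_cauchy_of_approx {X : Type*} [PseudoMetricSpace X] (a : ℕ → X)
    (h : ∀ ε > 0, ∃ b : ℕ → X, CauchySeq b ∧ ∀ j, dist (a j) (b j) ≤ ε) : CauchySeq a := by
  rw [Metric.cauchySeq_iff']
  intro ε hε
  obtain ⟨b, hb, hab⟩ := h (ε / 3) (by positivity)
  obtain ⟨n, hn⟩ := Metric.cauchySeq_iff'.1 hb (ε / 3) (by positivity)
  refine ⟨n, fun m hm => ?_⟩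
  have h1 := hab m
  have h2 := hab n
  have h3 := hn m hm
  have h4 := dist_triangle4 (a m) (b m) (b n) (a n)
  rw [dist_comm (b n)] at h4
  linarith

/-- Pointwise convergence of an equi-Lipschitz sequence is locally uniform. -/
lemma aux_locally_uniform {E G : Type*} [NormedAddCommGroup E] [NormedAddCommGroup G]
    (F : ℕ → E → G) (g : E → G) (L : ℝ) (hL : ∀ j x y, ‖F j y - F j x‖ ≤ L * ‖y - x‖)
    (hF : ∀ x, Tendsto (fun j => F j x) atTop (nhds (g x))) :
    TendstoLocallyUniformly F g atTop := by
  have hg : ∀ x y, ‖g y - g x‖ ≤ L * ‖y - x‖ := fun x y =>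
    le_of_tendsto ((hF y).sub (hF x)).norm (Eventually.of_forall fun j => hL j x y)
  rw [Metric.tendstoLocallyUniformly_iff]
  intro ε hε x
  have hδ : 0 < ε / (3 * (|L| + 1)) := by positivity
  refine ⟨Metric.ball x (ε / (3 * (|L| + 1))), Metric.ball_mem_nhds _ hδ, ?_⟩
  filter_upwards [Metric.tendsto_nhds.1 (hF x) (ε / 3) (by positivity)] with j hj y hy
  have hy' : ‖y - x‖ < ε / (3 * (|L| + 1)) := by simpa [dist_eq_norm] using hy
  have hb : L * ‖y - x‖ ≤ ε / 3 := by
    calc L * ‖y - x‖ ≤ (|L| + 1) * (ε / (3 * (|L| + 1))) := by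
          apply mul_le_mul _ hy'.le (norm_nonneg _) (by positivity)
          linarith [le_abs_self L]
      _ = ε / 3 := by field_simp
  have h1 := hg x y
  have h2 := hL j x y
  rw [← dist_eq_norm] at h1 h2
  have h4 := dist_triangle4 (g y) (g x) (F j x) (F j y)
  rw [dist_comm (g x), dist_comm (F j x) (F j y)] at h4
  linarith

/-- If a sequence converges pointwise and its derivatives are equi-Lipschitz, the derivatives
are pointwise Cauchy. -/
lemma aux_cauchy_fderiv {E G : Type*} [NormedAddCommGroup E] [NormedSpace ℝ E]
    [FiniteDimensional ℝ E] [NormedAddCommGroup G] [NormedSpace ℝ G] (F : ℕ → E → G)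
    (hd : ∀ j, Differentiable ℝ (F j)) (L : ℝ)
    (hL : ∀ j x y, ‖fderiv ℝ (F j) y - fderiv ℝ (F j) x‖ ≤ L * ‖y - x‖)
    (hF : ∀ x, CauchySeq (fun j => F j x)) (x : E) :
    CauchySeq (fun j => fderiv ℝ (F j) x) := by
  have key : ∀ v, CauchySeq (fun j => fderiv ℝ (F j) x v) := by
    intro v
    apply aux_cauchy_of_approx
    intro ε hε
    have hM : 0 < |L| * ‖v‖ ^ 2 + 1 := by positivity
    obtain ⟨t, ht0, ht⟩ : ∃ t > 0, t * (|L| * ‖v‖ ^ 2 + 1) = ε :=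
      ⟨ε / (|L| * ‖v‖ ^ 2 + 1), by positivity, by field_simp⟩
    refine ⟨fun j => t⁻¹ • (F j (x + t • v) - F j x), ?_, fun j => ?_⟩
    · have h1 : CauchySeq (fun j => F j (x + t • v) - F j x) := by
        have := (hF (x + t • v)).prodMk (hF x)
        exact uniformContinuous_sub.comp_cauchySeq this
      exact (uniformContinuous_const_smul t⁻¹).comp_cauchySeq h1
    · have h2 := (convex_closedBall x (t * ‖v‖)).norm_image_sub_le_of_norm_fderiv_le'
        (𝕜 := ℝ) (f := F j) (φ := fderiv ℝ (F j) x) (C := |L| * (t * ‖v‖)) (x := x)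
        (y := x + t • v) (fun y _ => (hd j) y) (fun y hy => by
          refine (hL j x y).trans ?_
          rw [Metric.mem_closedBall, dist_eq_norm] at hy
          exact mul_le_mul (le_abs_self L) hy (norm_nonneg _) (abs_nonneg _))
        (Metric.mem_closedBall_self (by positivity))
        (by simp [dist_eq_norm, norm_smul, abs_of_pos ht0])
      rw [add_sub_cancel_left, norm_smul, Real.norm_of_nonneg ht0.le] at h2
      have h3 : fderiv ℝ (F j) x v - t⁻¹ • (F j (x + t • v) - F j x) =
          -(t⁻¹ • (F j (x + t • v) - F j x - fderiv ℝ (F j) x (t • v))) := by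
        rw [map_smul, smul_sub t⁻¹ _ (t • _), inv_smul_smul₀ ht0.ne']
        abel
      rw [dist_eq_norm, h3, norm_neg, norm_smul, norm_inv, Real.norm_of_nonneg ht0.le,
        inv_mul_le_iff₀ ht0]
      refine h2.trans ?_
      rw [← ht]
      nlinarith [mul_pos ht0 ht0]
  obtain ⟨C, hC, hop⟩ := (Module.finBasis ℝ E).exists_opNorm_le (𝕜 := ℝ) (F := G)
  rw [Metric.cauchySeq_iff]
  intro ε hε
  choose n hn using fun i => Metric.cauchySeq_iff.1 (key (Module.finBasis ℝ E i)) (ε / (2 * C))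
    (by positivity)
  refine ⟨Finset.univ.sup n, fun m hm k hk => ?_⟩
  rw [dist_eq_norm]
  have := hop (u := fderiv ℝ (F m) x - fderiv ℝ (F k) x) (M := ε / (2 * C)) (by positivity) (fun i => by
    have := hn i m ((Finset.le_sup (Finset.mem_univ i)).trans hm) k
      ((Finset.le_sup (Finset.mem_univ i)).trans hk)
    rw [dist_eq_norm] at this
    simpa using this.le)
  refine this.trans_lt ?_
  have : C * (ε / (2 * C)) = ε / 2 := by field_simp
  linarith

/-- Distributional convergence of an equi-Lipschitz sequence gives pointwise convergence. -/
lemma aux_cauchy_of_distrib {N : ℕ} (f : ℕ → EuclideanSpace ℝ (Fin N) → ℂ) (L : ℝ)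
    (hL : ∀ j x y, ‖f j y - f j x‖ ≤ L * ‖y - x‖) (hc : ∀ j, Continuous (f j))
    (hf_conv : ∀ φ : SchwartzMap (EuclideanSpace ℝ (Fin N)) ℂ,
      ∃ l : ℂ, Tendsto (fun j => ∫ x, f j x * φ x) atTop (nhds l))
    (x : EuclideanSpace ℝ (Fin N)) : CauchySeq (fun j => f j x) := by
  apply aux_cauchy_of_approx
  intro ε hε
  have hδ : 0 < ε / (|L| + 1) := by positivity
  let ψ : ContDiffBump x := ⟨ε / (|L| + 1) / 2, ε / (|L| + 1), by positivity, by linarith⟩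
  have hψc : HasCompactSupport (fun y => (ψ.normed volume y : ℂ)) :=
    (ψ.hasCompactSupport_normed (μ := volume)).comp_left (g := fun r : ℝ => (r : ℂ)) (by simp)
  have hψs : ContDiff ℝ (⊤ : ℕ∞) (fun y => (ψ.normed volume y : ℂ)) :=
    Complex.ofRealCLM.contDiff.comp ψ.contDiff_normed
  obtain ⟨l, hl⟩ := hf_conv (hψc.toSchwartzMap hψs)
  refine ⟨_, hl.cauchySeq, fun j => ?_⟩
  have hi : Integrable (fun y => (ψ.normed volume y : ℂ)) :=
    hψs.continuous.integrable_of_hasCompactSupport hψc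
  have hi2 : Integrable (fun y => f j y * (ψ.normed volume y : ℂ)) :=
    ((hc j).mul hψs.continuous).integrable_of_hasCompactSupport hψc.mul_left
  have h1 : ∫ y, f j x * (ψ.normed volume y : ℂ) = f j x := by
    rw [integral_const_mul, integral_complex_ofReal, ψ.integral_normed]
    simp
  have h2 : f j x - ∫ y, f j y * (ψ.normed volume y : ℂ) =
      ∫ y, (f j x - f j y) * (ψ.normed volume y : ℂ) := by
    simp_rw [sub_mul]
    rw [integral_sub (hi.const_mul _) hi2, h1]
  change dist (f j x) (∫ y, f j y * (ψ.normed volume y : ℂ)) ≤ ε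
  rw [dist_eq_norm, h2]
  have h3 : ∫ y, ε * ψ.normed volume y = ε := by
    rw [integral_const_mul, ψ.integral_normed, mul_one]
  rw [← h3]
  apply norm_integral_le_of_norm_le (ψ.integrable_normed.const_mul _)
  refine Eventually.of_forall fun y => ?_
  rw [norm_mul, Complex.norm_real, Real.norm_of_nonneg (ψ.nonneg_normed y)]
  by_cases hy : y ∈ Metric.ball x (ε / (|L| + 1))
  · apply mul_le_mul_of_nonneg_right _ (ψ.nonneg_normed y)
    rw [Metric.mem_ball, dist_comm, dist_eq_norm] at hy
    calc _ ≤ L * ‖x - y‖ := hL j y x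
      _ ≤ (|L| + 1) * (ε / (|L| + 1)) := by
          apply mul_le_mul _ hy.le (norm_nonneg _) (by positivity)
          linarith [le_abs_self L]
      _ = ε := by field_simp
  · have : ψ.normed volume y = 0 := by
      rw [← Function.notMem_support, ψ.support_normed_eq]
      exact hy
    simp [this]

/-- Arzelà–Ascoli-type lemma: a sequence of smooth functions on `ℝ^N`, bounded in every `C^k`
norm and whose integrals against every Schwartz function converge, converges together with all
its derivatives uniformly on compact sets to a smooth function with bounded derivatives. -/
theorem smooth_limit_of_bounded_derivatives_and_distributional_convergence
    (N : ℕ) (hN : 1 ≤ N) (f : ℕ → EuclideanSpace ℝ (Fin N) → ℂ)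
    (hf_smooth : ∀ j, ContDiff ℝ (⊤ : ℕ∞) (f j))
    (hf_bdd : ∀ k : ℕ, ∃ C : ℝ, ∀ j x, ‖iteratedFDeriv ℝ k (f j) x‖ ≤ C)
    (hf_conv : ∀ φ : SchwartzMap (EuclideanSpace ℝ (Fin N)) ℂ,
      ∃ l : ℂ, Tendsto (fun j => ∫ x, f j x * φ x) atTop (nhds l)) :
    ∃ g : EuclideanSpace ℝ (Fin N) → ℂ,
      ContDiff ℝ (⊤ : ℕ∞) g ∧
      (∀ k : ℕ, ∃ C : ℝ, ∀ x, ‖iteratedFDeriv ℝ k g x‖ ≤ C) ∧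
      (∀ φ : SchwartzMap (EuclideanSpace ℝ (Fin N)) ℂ,
        Tendsto (fun j => ∫ x, f j x * φ x) atTop (nhds (∫ x, g x * φ x))) ∧
      (∀ (k : ℕ) (K : Set (EuclideanSpace ℝ (Fin N))), IsCompact K →
        TendstoUniformlyOn (fun j => iteratedFDeriv ℝ k (f j)) (iteratedFDeriv ℝ k g)
          atTop K) := by
  classical
  choose C hC using hf_bdd
  have hdiff : ∀ k j, Differentiable ℝ (iteratedFDeriv ℝ k (f j)) := fun k j =>
    (hf_smooth j).differentiable_iteratedFDeriv (by exact_mod_cast WithTop.coe_lt_top k)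
  have hLip : ∀ k j x y, ‖iteratedFDeriv ℝ k (f j) y - iteratedFDeriv ℝ k (f j) x‖
      ≤ C (k + 1) * ‖y - x‖ := fun k j x y =>
    convex_univ.norm_image_sub_le_of_norm_fderiv_le (𝕜 := ℝ) (fun z _ => hdiff k j z)
      (fun z _ => by rw [norm_fderiv_iteratedFDeriv]; exact hC (k + 1) j z)
      (Set.mem_univ x) (Set.mem_univ y)
  have hLip' : ∀ k j x y, ‖fderiv ℝ (iteratedFDeriv ℝ k (f j)) y -
      fderiv ℝ (iteratedFDeriv ℝ k (f j)) x‖ ≤ C (k + 2) * ‖y - x‖ := fun k j x y => by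
    have := hLip (k + 1) j x y
    rw [iteratedFDeriv_succ_eq_comp_left, Function.comp_apply, Function.comp_apply,
      ← dist_eq_norm, LinearIsometryEquiv.dist_map, dist_eq_norm] at this
    exact this
  have hcauchy : ∀ k x, CauchySeq (fun j => iteratedFDeriv ℝ k (f j) x) := by
    intro k
    induction k with
    | zero =>
      intro x
      have h0 := aux_cauchy_of_distrib f (C 1) (fun j x y => by
        have := hLip 0 j x y
        rw [iteratedFDeriv_zero_eq_comp] at this
        simpa only [Function.comp_apply, ← dist_eq_norm, LinearIsometryEquiv.dist_map] using this)
        (fun j => (hf_smooth j).continuous) hf_conv x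
      exact (LinearIsometryEquiv.isometry (continuousMultilinearCurryFin0 ℝ
        (EuclideanSpace ℝ (Fin N)) ℂ).symm).uniformContinuous.comp_cauchySeq h0
    | succ k ih =>
      intro x
      have h0 := aux_cauchy_fderiv (fun j => iteratedFDeriv ℝ k (f j)) (hdiff k) (C (k + 2))
        (hLip' k)
        ih x
      exact (LinearIsometryEquiv.isometry (continuousMultilinearCurryLeftEquiv ℝ
        (fun _ : Fin (k + 1) => EuclideanSpace ℝ (Fin N)) ℂ).symm).uniformContinuous.comp_cauchySeq
          h0
  choose p hp using fun x k => cauchySeq_tendsto_of_complete (hcauchy k x)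
  have hloc : ∀ k, TendstoLocallyUniformly (fun j => iteratedFDeriv ℝ k (f j))
      (fun x => p x k) atTop := fun k =>
    aux_locally_uniform _ _ (C (k + 1)) (hLip k) (fun x => hp x k)
  have hder : ∀ k x, HasFDerivAt (fun x => p x k) (p x (k + 1)).curryLeft x := by
    intro k x
    refine hasFDerivAt_of_tendstoLocallyUniformlyOn (l := atTop)
      (f := fun j => iteratedFDeriv ℝ k (f j)) (g' := fun x => (p x (k + 1)).curryLeft)
      (f' := fun j => fderiv ℝ (iteratedFDeriv ℝ k (f j))) isOpen_univ ?_
      (fun j z _ => (hdiff k j z).hasFDerivAt) (fun z _ => hp z k) (Set.mem_univ x)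
    rw [tendstoLocallyUniformlyOn_univ]
    refine aux_locally_uniform _ _ (C (k + 2)) (hLip' k) ?_
    · intro z
      have := ((continuousMultilinearCurryLeftEquiv ℝ
        (fun _ : Fin (k + 1) => EuclideanSpace ℝ (Fin N)) ℂ).continuous.tendsto _).comp
          (hp z (k + 1))
      refine this.congr fun j => ?_
      simp [iteratedFDeriv_succ_eq_comp_left]
  have hT : HasFTaylorSeriesUpTo (⊤ : ℕ∞) (fun x => (p x 0).curry0) p :=
    { zero_eq := fun x => rfl
      fderiv := fun m _ x => hder m x
      cont := fun m _ => continuous_iff_continuousAt.2 fun x => (hder m x).continuousAt }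
  have hgs : ContDiff ℝ (⊤ : ℕ∞) (fun x => (p x 0).curry0) := hT.contDiff
  have hEq : ∀ k, iteratedFDeriv ℝ k (fun x => (p x 0).curry0) = fun x => p x k := fun k =>
    funext fun x => (hT.eq_iteratedFDeriv (by exact_mod_cast le_top) x).symm
  refine ⟨fun x => (p x 0).curry0, hgs, ?_, ?_, ?_⟩
  · intro k
    refine ⟨C k, fun x => ?_⟩
    rw [hEq]
    exact le_of_tendsto (hp x k).norm (Eventually.of_forall fun j => hC k j x)
  · intro φ
    refine tendsto_integral_of_dominated_convergence (fun x => C 0 * ‖φ x‖) ?_ ?_ ?_ ?_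
    · exact fun j => ((hf_smooth j).continuous.mul φ.continuous).aestronglyMeasurable
    · exact (φ.integrable (μ := volume)).norm.const_mul _
    · refine fun j => Eventually.of_forall fun x => ?_
      rw [norm_mul]
      have := hC 0 j x
      rw [norm_iteratedFDeriv_zero] at this
      gcongr
    · refine Eventually.of_forall fun x => Tendsto.mul_const _ ?_
      exact ((continuousMultilinearCurryFin0 ℝ (EuclideanSpace ℝ (Fin N))
        ℂ).continuous.tendsto _).comp (hp x 0)
  · intro k K hK
    rw [hEq]
    exact (tendstoLocallyUniformlyOn_iff_tendstoUniformlyOn_of_compact hK).1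
      (hloc k).tendstoLocallyUniformlyOn
end
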